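/- (Uniform Sobolev inequality on the unit ball.) There is a constant C₁(n,β)=(1+4ⁿ)(n+β−1) such that for every exponent q with 1 ≤ q ≤ nβ/(n+β−1) (hence q<n) and every w ∈ W^{1,q}(B₁), one has ‖w‖_{L^{q*}(B₁)} ≤ C₁(n,β)‖w‖_{W^{1,q}(B₁)}, where q* = nq/(n−q). -/

import Mathlib

open Real Set MeasureTheory Metric
open scoped ENNReal

theorem enorm_le_lintegral_of_deriv_le {f : ℝ → ℝ} (hc : Continuous f)
    (hf : HasCompactSupport f) {s : Set ℝ} (hs : s.Countable)
    (hd : ∀ t ∉ s, DifferentiableAt ℝ f t) {g : ℝ → ℝ≥0∞}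
    (hg : ∀ t ∉ s, ‖deriv f t‖ₑ ≤ g t) (x : ℝ) :
    ‖f x‖ₑ ≤ ∫⁻ t, g t := by
  have hae : ∀ᵐ t, ‖deriv f t‖ₑ ≤ g t := by
    filter_upwards [hs.ae_notMem volume] with t ht using hg t ht
  have hle : ∫⁻ t, ‖deriv f t‖ₑ ≤ ∫⁻ t, g t := lintegral_mono_ae hae
  by_cases htop : ∫⁻ t, g t = ∞
  · simp [htop]
  have hint : Integrable (deriv f) :=
    ⟨(measurable_deriv f).aestronglyMeasurable, hle.trans_lt (lt_top_iff_ne_top.2 htop)⟩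
  obtain ⟨a, ha, hax⟩ : ∃ a, f a = 0 ∧ a ≤ x := by
    obtain ⟨R, hR⟩ := hf.isCompact.isBounded.subset_closedBall (0 : ℝ)
    refine ⟨min x (-|R| - 1), ?_, min_le_left _ _⟩
    by_contra h
    have h1 := hR (subset_tsupport f h)
    rw [mem_closedBall_zero_iff, Real.norm_eq_abs] at h1
    have h2 := (abs_le.1 h1).1
    have h3 := min_le_right x (-|R| - 1)
    have h4 := le_abs_self R
    linarith
  have key := integral_eq_of_hasDerivAt_off_countable f (deriv f) (a := a) (b := x) hs
    hc.continuousOn (fun t ht => (hd t ht.2).hasDerivAt) hint.intervalIntegrable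
  rw [ha, sub_zero, intervalIntegral.integral_of_le hax] at key
  rw [← key]
  exact (enorm_integral_le_lintegral_enorm _).trans ((setLIntegral_le_lintegral _ _).trans hle)

theorem exists_hasDerivAt_abs_eq_rpow {γ : ℝ} (hγ : 1 ≤ γ) :
    ∃ φ φ' : ℝ → ℝ, (∀ t, HasDerivAt φ (φ' t) t) ∧ (∀ t, |φ t| = |t| ^ γ) ∧
      ∀ t, |φ' t| = γ * |t| ^ (γ - 1) := by
  rcases hγ.eq_or_lt with rfl | hγ
  · exact ⟨id, fun _ => 1, hasDerivAt_id, by simp, by simp⟩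
  · refine ⟨fun t => |t| ^ γ, fun t => γ * |t| ^ (γ - 2) * t,
      fun t => hasDerivAt_abs_rpow t hγ, fun t => abs_of_nonneg (by positivity), fun t => ?_⟩
    rw [abs_mul, abs_of_nonneg (by positivity : 0 ≤ γ * |t| ^ (γ - 2)), mul_assoc]
    rcases eq_or_ne t 0 with rfl | ht
    · simp [Real.zero_rpow (by linarith : γ - 1 ≠ 0)]
    · rw [← Real.rpow_add_one (abs_pos.2 ht).ne']
      ring_nf

theorem lintegral_enorm_rpow_le_of_gridLines {ι : Type*} [Fintype ι] [DecidableEq ι] {p : ℝ}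
    (hp : Real.HolderConjugate (Fintype.card ι) p) {u F : (ι → ℝ) → ℝ≥0∞} (hF : Measurable F)
    (h : ∀ x i, u x ≤ ∫⁻ t, F (Function.update x i t)) :
    ∫⁻ x, u x ^ p ≤ (∫⁻ x, F x) ^ p := by
  have h1 : (0 : ℝ) < Fintype.card ι - 1 := sub_pos.2 hp.lt
  calc ∫⁻ x, u x ^ p
      = ∫⁻ x, ∏ _i : ι, u x ^ (1 / (Fintype.card ι - 1 : ℝ)) := by
        congr! 2 with x
        rw [Finset.prod_const, Finset.card_univ, ← ENNReal.rpow_natCast, ← ENNReal.rpow_mul,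
          hp.conjugate_eq]
        field_simp
    _ ≤ ∫⁻ x, ∏ i, (∫⁻ t, F (Function.update x i t)) ^ (1 / (Fintype.card ι - 1 : ℝ)) := by
        gcongr with x i
        exact h x i
    _ ≤ (∫⁻ x, F x) ^ p := lintegral_prod_lintegral_pow_le (fun _ => volume) hp hF

theorem hasDerivAt_toLp_update {n : ℕ} (x : Fin n → ℝ) (i : Fin n) (t : ℝ) :
    HasDerivAt (fun t => (WithLp.toLp 2 (Function.update x i t) : EuclideanSpace ℝ (Fin n)))
      (EuclideanSpace.single i 1) t :=
  (PiLp.continuousLinearEquiv 2 ℝ (fun _ : Fin n => ℝ)).symm.hasFDerivAt.comp_hasDerivAt t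
    (hasDerivAt_update x i t)

theorem lintegral_enorm_rpow_mul_le {n : ℕ} {p γ : ℝ} (hp : Real.HolderConjugate n p)
    (hγ : 1 ≤ γ) {u : EuclideanSpace ℝ (Fin n) → ℝ} (hc : Continuous u)
    (hu : HasCompactSupport u) {S : Set (EuclideanSpace ℝ (Fin n))}
    (hS : ∀ (x : Fin n → ℝ) i, {t | WithLp.toLp 2 (Function.update x i t) ∈ S}.Countable)
    (hd : ∀ x ∉ S, DifferentiableAt ℝ u x) :
    ∫⁻ x, ‖u x‖ₑ ^ (γ * p) ≤
      (∫⁻ x, ENNReal.ofReal γ * ‖u x‖ₑ ^ (γ - 1) * ‖fderiv ℝ u x‖ₑ) ^ p := by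
  obtain ⟨φ, φ', hφ, hφ1, hφ2⟩ := exists_hasDerivAt_abs_eq_rpow hγ
  set F : EuclideanSpace ℝ (Fin n) → ℝ≥0∞ :=
    fun x => ENNReal.ofReal γ * ‖u x‖ₑ ^ (γ - 1) * ‖fderiv ℝ u x‖ₑ with hFdef
  have hF : Measurable F := by
    have := (measurable_fderiv ℝ u).enorm
    have := hc.measurable
    fun_prop
  have hvp := PiLp.volume_preserving_toLp (Fin n)
  have hemb : MeasurableEmbedding (WithLp.toLp 2 : (Fin n → ℝ) → EuclideanSpace ℝ (Fin n)) :=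
    (MeasurableEquiv.toLp 2 (Fin n → ℝ)).measurableEmbedding
  rw [← hvp.lintegral_comp_emb hemb, ← hvp.lintegral_comp_emb hemb]
  simp_rw [ENNReal.rpow_mul]
  have e1 : ∀ t : ℝ, ‖φ t‖ₑ = ‖t‖ₑ ^ γ := fun t => by
    rw [← ofReal_norm, ← ofReal_norm, Real.norm_eq_abs, Real.norm_eq_abs, hφ1,
      ENNReal.ofReal_rpow_of_nonneg (abs_nonneg _) (by linarith)]
  have e2 : ∀ t : ℝ, ‖φ' t‖ₑ = ENNReal.ofReal γ * ‖t‖ₑ ^ (γ - 1) := fun t => by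
    rw [← ofReal_norm, ← ofReal_norm, Real.norm_eq_abs, Real.norm_eq_abs, hφ2,
      ENNReal.ofReal_rpow_of_nonneg (abs_nonneg _) (by linarith),
      ENNReal.ofReal_mul (by linarith)]
  have hφ0 : φ 0 = 0 := by
    have := hφ1 0
    rwa [abs_zero, Real.zero_rpow (by linarith), abs_eq_zero] at this
  refine lintegral_enorm_rpow_le_of_gridLines (p := p) (by simpa using hp)
    (F := fun x => F (WithLp.toLp 2 x)) (hF.comp hvp.measurable) fun x i => ?_
  set L : ℝ → EuclideanSpace ℝ (Fin n) := fun t => WithLp.toLp 2 (Function.update x i t) with hL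
  have hLd : ∀ t, HasDerivAt L (EuclideanSpace.single i 1) t := hasDerivAt_toLp_update x i
  have hLc : Continuous L := continuous_iff_continuousAt.2 fun t => (hLd t).continuousAt
  have hder : ∀ t ∉ {t | L t ∈ S}, HasDerivAt (fun t => φ (u (L t)))
      (φ' (u (L t)) * fderiv ℝ u (L t) (EuclideanSpace.single i 1)) t := fun t ht =>
    (hφ _).comp t ((hd _ ht).hasFDerivAt.comp_hasDerivAt t (hLd t))
  have hsupp : HasCompactSupport (fun t => φ (u (L t))) := by
    obtain ⟨R, hR⟩ := hu.isCompact.isBounded.subset_closedBall (0 : EuclideanSpace ℝ (Fin n))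
    refine HasCompactSupport.of_support_subset_isCompact (isCompact_closedBall (0 : ℝ) R)
      fun t ht => ?_
    have h0 : u (L t) ≠ 0 := fun h => ht (by simp [h, hφ0])
    have h1 := hR (subset_tsupport u h0)
    rw [mem_closedBall_zero_iff] at h1 ⊢
    refine le_trans ?_ h1
    simpa [hL] using PiLp.norm_apply_le (L t) i
  have := enorm_le_lintegral_of_deriv_le (f := fun t => φ (u (L t)))
    ((continuous_iff_continuousAt.2 fun t => (hφ t).continuousAt).comp (hc.comp hLc)) hsupp
    (hS x i) (fun t ht => (hder t ht).differentiableAt) (g := fun t => F (L t))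
    (fun t ht => by
      rw [(hder t ht).deriv, enorm_mul, e2]
      simp only [hFdef]
      gcongr
      refine (ContinuousLinearMap.le_opENorm _ _).trans ?_
      simp [← ofReal_norm]) (x i)
  simpa [hL, e1] using this

theorem sobolev_of_hasCompactSupport {n : ℕ} (hn : 2 ≤ n) {q : ℝ} (hq : 1 ≤ q) (hqn : q < n)
    {u : EuclideanSpace ℝ (Fin n) → ℝ} (hc : Continuous u)
    (hu : HasCompactSupport u) {S : Set (EuclideanSpace ℝ (Fin n))}
    (hS : ∀ (x : Fin n → ℝ) i, {t | WithLp.toLp 2 (Function.update x i t) ∈ S}.Countable)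
    (hd : ∀ x ∉ S, DifferentiableAt ℝ u x) :
    (∫⁻ x, ‖u x‖ₑ ^ (n * q / (n - q))) ^ ((n - q) / (n * q)) ≤
      ENNReal.ofReal (q * (n - 1) / (n - q)) * (∫⁻ x, ‖fderiv ℝ u x‖ₑ ^ q) ^ (1 / q) := by
  have hn' : (2 : ℝ) ≤ n := by exact_mod_cast hn
  have hnq : 0 < n - q := sub_pos.2 hqn
  have hn1 : (0 : ℝ) < n - 1 := by linarith
  set γ : ℝ := q * (n - 1) / (n - q) with hγdef
  set s : ℝ := n * q / (n - q) with hsdef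
  set p : ℝ := n / (n - 1) with hpdef
  have hγ : 1 ≤ γ := by
    rw [hγdef, le_div_iff₀ hnq]
    nlinarith
  have hs : 0 < s := by positivity
  have hp0 : 0 < p := by positivity
  have hp : Real.HolderConjugate n p := Real.HolderConjugate.conjExponent (by linarith)
  have hγp : γ * p = s := by
    rw [hγdef, hpdef, hsdef]; field_simp
  have hγ1 : γ - 1 = s * (1 - 1 / q) := by
    rw [hγdef, hsdef]; field_simp; ring
  have hps : 1 / p = 1 / s + (1 - 1 / q) := by
    rw [hpdef, hsdef]; field_simp; ring
  have hs1 : (n - q) / (n * q) = 1 / s := by rw [hsdef, one_div_div]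
  have hq1 : 0 ≤ 1 - 1 / q := sub_nonneg.2 ((div_le_one (by linarith)).2 hq)
  rw [hs1]
  set A := ∫⁻ x, ‖u x‖ₑ ^ s with hA
  set B := ∫⁻ x, ‖fderiv ℝ u x‖ₑ ^ q with hB
  have hAtop : A ≠ ∞ := by
    have := (hc.memLp_of_hasCompactSupport (μ := volume) (p := ENNReal.ofReal s) hu).2
    have := lintegral_rpow_enorm_lt_top_of_eLpNorm_lt_top (by simpa using hs) (by simp) this
    rw [ENNReal.toReal_ofReal hs.le] at this
    exact this.ne
  have h1 : A ≤ (ENNReal.ofReal γ * (A ^ (1 - 1 / q) * B ^ (1 / q))) ^ p := by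
    refine (hγp ▸ lintegral_enorm_rpow_mul_le hp hγ hc hu hS hd).trans ?_
    gcongr
    simp_rw [mul_assoc]
    rw [lintegral_const_mul' _ _ ENNReal.ofReal_ne_top]
    gcongr
    have hm1 : AEMeasurable (fun x => ‖u x‖ₑ ^ s) := by
      have := hc.measurable
      fun_prop
    have hm2 : AEMeasurable (fun x => ‖fderiv ℝ u x‖ₑ ^ q) :=
      ((measurable_fderiv ℝ u).enorm.pow_const _).aemeasurable
    have := ENNReal.lintegral_mul_norm_pow_le hm1 hm2 hq1 (by positivity : 0 ≤ 1 / q)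
      (by ring)
    refine le_trans (le_of_eq ?_) this
    congr! 2 with x
    rw [← ENNReal.rpow_mul, ← ENNReal.rpow_mul, ← hγ1, mul_one_div_cancel (by positivity),
      ENNReal.rpow_one]
  rcases eq_or_ne A 0 with h0 | h0
  · simp [h0, ENNReal.zero_rpow_of_pos (inv_pos.2 hs)]
  have h2 : A ^ (1 / p) ≤ ENNReal.ofReal γ * (A ^ (1 - 1 / q) * B ^ (1 / q)) := by
    rwa [one_div, ENNReal.rpow_inv_le_iff hp0]
  rw [hps, ENNReal.rpow_add _ _ h0 hAtop] at h2
  have h3 : A ^ (1 - 1 / q) ≠ 0 := by simp [ENNReal.rpow_eq_zero_iff, h0, hAtop]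
  have h4 : A ^ (1 - 1 / q) ≠ ∞ := ENNReal.rpow_ne_top_of_nonneg hq1 hAtop
  rw [← ENNReal.mul_le_mul_iff_left h3 h4]
  exact h2.trans (le_of_eq (by ring))

theorem countable_norm_toLp_update_eq {n : ℕ} (x : Fin n → ℝ) (i : Fin n) (c : ℝ) :
    {t | ‖(WithLp.toLp 2 (Function.update x i t) : EuclideanSpace ℝ (Fin n))‖ = c}.Countable := by
  set K : ℝ := ∑ j ∈ Finset.univ.erase i, x j ^ 2
  refine Set.Countable.mono (s₂ := {√(c ^ 2 - K), -√(c ^ 2 - K)}) (fun t ht => ?_)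
    (Set.Finite.countable (by simp))
  have h1 : t ^ 2 + K = c ^ 2 := by
    rw [← show _ = c from ht, EuclideanSpace.real_norm_sq_eq,
      ← Finset.add_sum_erase _ _ (Finset.mem_univ i)]
    congr 1
    · simp
    · refine Finset.sum_congr rfl fun j hj => ?_
      simp [Function.update_of_ne (Finset.ne_of_mem_erase hj)]
  rw [← h1, add_sub_cancel_right, Real.sqrt_sq_eq_abs]
  rcases abs_choice t with h | h <;> simp [h]

section Reflection

variable {n : ℕ}

/-- The retraction of the space onto the closed ball of radius `r`, given outside this ball by
the inversion in its boundary sphere. -/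
noncomputable def sphereRetract (r : ℝ) (x : EuclideanSpace ℝ (Fin n)) :
    EuclideanSpace ℝ (Fin n) :=
  (r / max r ‖x‖) ^ 2 • x

/-- The extension of `w` from the ball of radius `r` by reflection across its boundary sphere,
cut off linearly between the radii `r` and `2 * r`. -/
noncomputable def reflectExtend (r : ℝ) (w : EuclideanSpace ℝ (Fin n) → ℝ)
    (x : EuclideanSpace ℝ (Fin n)) : ℝ :=
  min 1 (max 0 (2 - ‖x‖ / r)) * w (sphereRetract r x)

variable {r : ℝ} {w : EuclideanSpace ℝ (Fin n) → ℝ} {x : EuclideanSpace ℝ (Fin n)}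

theorem norm_sphereRetract_le (hr : 0 < r) (x : EuclideanSpace ℝ (Fin n)) :
    ‖sphereRetract r x‖ ≤ r := by
  have hm : 0 < max r ‖x‖ := lt_max_of_lt_left hr
  rw [sphereRetract, norm_smul, norm_pow, norm_div, Real.norm_of_nonneg hr.le,
    Real.norm_of_nonneg hm.le, div_pow, div_mul_eq_mul_div, div_le_iff₀ (by positivity), sq, sq,
    mul_assoc]
  gcongr
  · exact le_max_left _ _
  · exact le_max_right _ _

theorem continuous_sphereRetract (hr : 0 < r) :
    Continuous (sphereRetract r : EuclideanSpace ℝ (Fin n) → _) := by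
  have : ∀ x : EuclideanSpace ℝ (Fin n), max r ‖x‖ ≠ 0 := fun x => (lt_max_of_lt_left hr).ne'
  unfold sphereRetract
  fun_prop (disch := assumption)

theorem continuous_reflectExtend (hr : 0 < r) (hw : ContinuousOn w (closedBall 0 r)) :
    Continuous (reflectExtend r w) := by
  have : Continuous fun x => w (sphereRetract r x) :=
    hw.comp_continuous (continuous_sphereRetract hr) fun x => by
      simpa using norm_sphereRetract_le hr x
  unfold reflectExtend
  refine Continuous.mul ?_ this
  fun_prop

theorem hasCompactSupport_reflectExtend (hr : 0 < r) :
    HasCompactSupport (reflectExtend r w) := by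
  refine HasCompactSupport.of_support_subset_isCompact (isCompact_closedBall 0 (2 * r))
    fun x hx => ?_
  rw [mem_closedBall_zero_iff]
  by_contra! h
  refine hx ?_
  have : 2 - ‖x‖ / r ≤ 0 := by
    rw [sub_nonpos, le_div_iff₀ hr]
    exact h.le
  simp [reflectExtend, max_eq_left this]

theorem reflectExtend_of_norm_le (hr : 0 < r) (hx : ‖x‖ ≤ r) : reflectExtend r w x = w x := by
  have : 1 ≤ 2 - ‖x‖ / r := by
    have := (div_le_one hr).2 hx
    linarith
  rw [reflectExtend, sphereRetract, max_eq_left hx, max_eq_right (by linarith), min_eq_left this,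
    div_self hr.ne']
  simp

theorem reflectExtend_eq_inversion (hr : 0 < r) (hx : r ≤ ‖x‖) (hx2 : ‖x‖ ≤ 2 * r) :
    reflectExtend r w x = (2 - ‖x‖ / r) * w (EuclideanGeometry.inversion 0 r x) := by
  have h1 : 2 - ‖x‖ / r ≤ 1 := by
    have := (one_le_div hr).2 hx
    linarith
  have h2 : 0 ≤ 2 - ‖x‖ / r := by
    rw [sub_nonneg, div_le_iff₀ hr]
    exact hx2
  rw [reflectExtend, sphereRetract, max_eq_right hx, max_eq_right h2, min_eq_right h1]
  simp [EuclideanGeometry.inversion]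

theorem reflectExtend_of_two_mul_le (hr : 0 < r) (hx : 2 * r ≤ ‖x‖) :
    reflectExtend r w x = 0 := by
  have : 2 - ‖x‖ / r ≤ 0 := by
    rw [sub_nonpos, le_div_iff₀ hr]
    exact hx
  simp [reflectExtend, max_eq_left this]

theorem norm_inversion (r : ℝ) (x : EuclideanSpace ℝ (Fin n)) :
    ‖EuclideanGeometry.inversion 0 r x‖ = r ^ 2 / ‖x‖ := by
  simpa using EuclideanGeometry.dist_inversion_center (0 : EuclideanSpace ℝ (Fin n)) x r

theorem reflectExtend_eventuallyEq_of_norm_lt (hr : 0 < r) (hx : ‖x‖ < r) :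
    reflectExtend r w =ᶠ[nhds x] w := by
  filter_upwards [(continuous_norm.tendsto x).eventually_lt_const hx] with y hy
    using reflectExtend_of_norm_le hr hy.le

theorem reflectExtend_eventuallyEq_zero (hr : 0 < r) (hx : 2 * r < ‖x‖) :
    reflectExtend r w =ᶠ[nhds x] fun _ => 0 := by
  filter_upwards [(continuous_norm.tendsto x).eventually_const_lt hx] with y hy
    using reflectExtend_of_two_mul_le hr hy.le

theorem exists_hasFDerivAt_reflectExtend (hr : 0 < r)
    (hw : ∀ y, ‖y‖ < r → DifferentiableAt ℝ w y) (hx : r < ‖x‖) (hx2 : ‖x‖ < 2 * r) :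
    ∃ D : EuclideanSpace ℝ (Fin n) →L[ℝ] ℝ, HasFDerivAt (reflectExtend r w) D x ∧
      ‖D‖ ≤ r⁻¹ * ‖w (EuclideanGeometry.inversion 0 r x)‖ +
        ‖fderiv ℝ w (EuclideanGeometry.inversion 0 r x)‖ := by
  have hx0 : 0 < ‖x‖ := hr.trans hx
  have hxne : x ≠ 0 := norm_pos_iff.1 hx0
  have hev : reflectExtend r w =ᶠ[nhds x]
      fun y => (2 - ‖y‖ / r) * w (EuclideanGeometry.inversion 0 r y) := by
    filter_upwards [(continuous_norm.tendsto x).eventually_const_lt hx,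
      (continuous_norm.tendsto x).eventually_lt_const hx2] with y hy hy2
      using reflectExtend_eq_inversion hr hy.le hy2.le
  have hin : ‖EuclideanGeometry.inversion 0 r x‖ < r := by
    rw [norm_inversion r, div_lt_iff₀ hx0, sq]
    gcongr
  have hD1 := (hw _ hin).hasFDerivAt.comp x
    (EuclideanGeometry.hasFDerivAt_inversion (R := r) hxne)
  have hN : HasFDerivAt (fun y : EuclideanSpace ℝ (Fin n) => ‖y‖)
      (fderiv ℝ (fun y : EuclideanSpace ℝ (Fin n) => ‖y‖) x) x :=
    ((contDiffAt_norm ℝ hxne).differentiableAt one_ne_zero).hasFDerivAt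
  have hD2 := (hN.mul_const r⁻¹).const_sub 2
  have hD := hD2.mul hD1
  refine ⟨_, HasFDerivAt.congr_of_eventuallyEq hD hev, ?_⟩
  have hle1 : ‖x‖ / r ≤ 2 := (div_le_iff₀ hr).2 hx2.le
  have hle2 : 1 ≤ ‖x‖ / r := (one_le_div hr).2 hx.le
  have hN1 : ‖fderiv ℝ (fun y : EuclideanSpace ℝ (Fin n) => ‖y‖) x‖ ≤ 1 := by
    simpa using norm_fderiv_le_of_lipschitz ℝ (x₀ := x)
      (lipschitzWith_one_norm (E := EuclideanSpace ℝ (Fin n)))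
  refine (norm_add_le _ _).trans ?_
  rw [add_comm]
  gcongr ?_ + ?_
  · rw [norm_smul, norm_neg, norm_smul, norm_inv, Real.norm_of_nonneg hr.le, mul_comm]
    simp only [Function.comp]
    gcongr
    exact mul_le_of_le_one_right (by positivity) hN1
  · rw [norm_smul, Real.norm_of_nonneg (by rw [← div_eq_mul_inv]; linarith), ← div_eq_mul_inv]
    refine (mul_le_of_le_one_left (norm_nonneg _) (by linarith)).trans ?_
    refine (ContinuousLinearMap.opNorm_comp_le _ _).trans ?_
    refine mul_le_of_le_one_right (norm_nonneg _) ?_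
    rw [norm_smul, norm_pow, norm_div, Real.norm_of_nonneg hr.le, dist_zero_right, norm_norm]
    refine mul_le_one₀ (pow_le_one₀ (by positivity) ((div_le_one hx0).2 hx.le)) (norm_nonneg _) ?_
    exact ContinuousLinearMap.opNorm_le_bound _ zero_le_one fun y => by simp

theorem lintegral_comp_inversion_le (hr : 0 < r) (H : EuclideanSpace ℝ (Fin n) → ℝ≥0∞) :
    ∫⁻ x in {x | r < ‖x‖ ∧ ‖x‖ < 2 * r}, H (EuclideanGeometry.inversion 0 r x) ≤
      4 ^ n * ∫⁻ x in ball 0 r, H x := by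
  set T : Set (EuclideanSpace ℝ (Fin n)) := {y | r / 2 < ‖y‖ ∧ ‖y‖ < r} with hT
  have hTm : MeasurableSet T :=
    (measurableSet_lt measurable_const measurable_norm).inter
      (measurableSet_lt measurable_norm measurable_const)
  have hTne : ∀ y ∈ T, y ≠ 0 := fun y hy h => by
    have := hy.1
    rw [h, norm_zero] at this
    linarith
  have himg : {x : EuclideanSpace ℝ (Fin n) | r < ‖x‖ ∧ ‖x‖ < 2 * r} =
      EuclideanGeometry.inversion 0 r '' T := by
    ext x
    constructor
    · rintro ⟨h1, h2⟩
      refine ⟨EuclideanGeometry.inversion 0 r x, ?_, EuclideanGeometry.inversion_inversion _ hr.ne' _⟩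
      have hx0 : 0 < ‖x‖ := hr.trans h1
      simp only [hT, mem_ofPred_eq, norm_inversion r]
      rw [div_lt_iff₀ hx0, lt_div_iff₀ hx0]
      constructor <;> nlinarith
    · rintro ⟨y, hy, rfl⟩
      have hy0 : 0 < ‖y‖ := norm_pos_iff.2 (hTne y hy)
      simp only [mem_ofPred_eq, norm_inversion r]
      rw [div_lt_iff₀ hy0, lt_div_iff₀ hy0]
      have := hy.1
      have := hy.2
      constructor <;> nlinarith
  rw [himg, lintegral_image_eq_lintegral_abs_det_fderiv_mul volume hTm
    (fun y hy => (EuclideanGeometry.hasFDerivAt_inversion (R := r) (hTne y hy)).hasFDerivWithinAt)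
    (EuclideanGeometry.inversion_injective _ hr.ne').injOn, ← lintegral_const_mul' _ _ (by simp)]
  refine (setLIntegral_mono' (g := fun y => 4 ^ n * H y) hTm fun y hy => ?_).trans
    (lintegral_mono_set fun y hy => by simpa using hy.2)
  rw [EuclideanGeometry.inversion_inversion _ hr.ne']
  gcongr
  have hy0 : 0 < ‖y‖ := norm_pos_iff.2 (hTne y hy)
  have hdet : |((r / dist y 0) ^ 2 • ((ℝ ∙ (y - 0))ᗮ.reflection :
      EuclideanSpace ℝ (Fin n) →L[ℝ] EuclideanSpace ℝ (Fin n))).det| = ((r / ‖y‖) ^ 2) ^ n := by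
    have h1 : LinearMap.det (((ℝ ∙ (y - 0))ᗮ.reflection :
      EuclideanSpace ℝ (Fin n) →L[ℝ] EuclideanSpace ℝ (Fin n)) :
      EuclideanSpace ℝ (Fin n) →ₗ[ℝ] EuclideanSpace ℝ (Fin n)) = _ :=
        Submodule.det_reflection (ℝ ∙ (y - 0))ᗮ
    rw [ContinuousLinearMap.det, ContinuousLinearMap.toLinearMap_smul, LinearMap.det_smul, h1]
    simp [abs_mul, abs_pow]
  rw [hdet]
  refine ENNReal.ofReal_le_of_le_toReal ?_
  rw [ENNReal.toReal_pow]
  simp only [ENNReal.toReal_ofNat]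
  gcongr
  have : r / ‖y‖ ≤ 2 := by
    rw [div_le_iff₀ hy0]
    linarith [hy.1]
  have : 0 ≤ r / ‖y‖ := by positivity
  nlinarith

theorem one_add_two_rpow_mul_le {q : ℝ} (hq : 1 ≤ q) (n : ℕ) :
    1 + (2 : ℝ≥0∞) ^ (q - 1) * 4 ^ n ≤ (1 + 4 ^ n) ^ q := by
  have h4 : (1 : ℝ≥0∞) ≤ 4 ^ n := one_le_pow₀ (by norm_num)
  have h2 : (2 : ℝ≥0∞) ≤ 1 + 4 ^ n := by
    rw [← one_add_one_eq_two]
    gcongr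
  have hq' : 0 ≤ q - 1 := by linarith
  have h1 : (1 : ℝ≥0∞) ≤ 2 ^ (q - 1) := by
    simpa using ENNReal.rpow_le_rpow_of_exponent_le (x := 2) (by norm_num) hq'
  calc 1 + (2 : ℝ≥0∞) ^ (q - 1) * 4 ^ n ≤ 2 ^ (q - 1) + 2 ^ (q - 1) * 4 ^ n := by gcongr
    _ = 2 ^ (q - 1) * (1 + 4 ^ n) := by ring
    _ ≤ (1 + 4 ^ n) ^ (q - 1) * (1 + 4 ^ n) := by gcongr
    _ = (1 + 4 ^ n) ^ (q - 1) * (1 + 4 ^ n) ^ (1 : ℝ) := by rw [ENNReal.rpow_one]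
    _ = (1 + 4 ^ n) ^ q := by
      rw [← ENNReal.rpow_add _ _ (by positivity) (by simp), sub_add_cancel]

theorem differentiableAt_reflectExtend (hr : 0 < r)
    (hw : ∀ y, ‖y‖ < r → DifferentiableAt ℝ w y) (h1 : ‖x‖ ≠ r) (h2 : ‖x‖ ≠ 2 * r) :
    DifferentiableAt ℝ (reflectExtend r w) x := by
  rcases h1.lt_or_gt with h1 | h1
  · exact (reflectExtend_eventuallyEq_of_norm_lt hr h1).differentiableAt_iff.2 (hw _ h1)
  rcases h2.lt_or_gt with h2 | h2
  · obtain ⟨D, hD, -⟩ := exists_hasFDerivAt_reflectExtend hr hw h1 h2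
    exact hD.differentiableAt
  · exact (reflectExtend_eventuallyEq_zero hr h2).differentiableAt_iff.2
      (differentiableAt_const _)

theorem lintegral_enorm_fderiv_reflectExtend_le (hn : n ≠ 0) {q : ℝ} (hq : 1 ≤ q) (hr : 0 < r)
    (hr1 : r ≤ 1) (hw : ∀ y, ‖y‖ < r → DifferentiableAt ℝ w y) :
    ∫⁻ x, ‖fderiv ℝ (reflectExtend r w) x‖ₑ ^ q ≤
      (ENNReal.ofReal r⁻¹ * (1 + 4 ^ n)) ^ q *
        ∫⁻ x in ball 0 r, (‖w x‖ₑ ^ q + ‖fderiv ℝ w x‖ₑ ^ q) := by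
  have : Nontrivial (EuclideanSpace ℝ (Fin n)) :=
    Module.nontrivial_of_finrank_pos (R := ℝ) (by simpa using Nat.pos_of_ne_zero hn)
  have hq0 : 0 ≤ q := by linarith
  set c : ℝ≥0∞ := ENNReal.ofReal r⁻¹ with hc
  have hc1 : 1 ≤ c := by
    rw [hc, ← ENNReal.ofReal_one]
    exact ENNReal.ofReal_le_ofReal ((one_le_inv₀ hr).2 hr1)
  set H : EuclideanSpace ℝ (Fin n) → ℝ≥0∞ := fun x => ‖w x‖ₑ ^ q + ‖fderiv ℝ w x‖ₑ ^ q with hH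
  set T : Set (EuclideanSpace ℝ (Fin n)) := {x | r < ‖x‖ ∧ ‖x‖ < 2 * r} with hT
  have hTm : MeasurableSet T :=
    (measurableSet_lt measurable_const measurable_norm).inter
      (measurableSet_lt measurable_norm measurable_const)
  set K : ℝ≥0∞ := c ^ q * 2 ^ (q - 1) with hK
  have hKtop : K ≠ ∞ := ENNReal.mul_ne_top
    (ENNReal.rpow_ne_top_of_nonneg hq0 ENNReal.ofReal_ne_top)
    (ENNReal.rpow_ne_top_of_nonneg (by linarith) (by simp))
  have hae : ∀ᵐ x : EuclideanSpace ℝ (Fin n), ‖fderiv ℝ (reflectExtend r w) x‖ₑ ^ q ≤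
      (ball 0 r).indicator (fun x => ‖fderiv ℝ w x‖ₑ ^ q) x +
        T.indicator (fun x => K * H (EuclideanGeometry.inversion 0 r x)) x := by
    have hs : ∀ ρ : ℝ, ∀ᵐ x : EuclideanSpace ℝ (Fin n), ‖x‖ ≠ ρ := fun ρ => by
      have := measure_eq_zero_iff_ae_notMem.1
        (Measure.addHaar_sphere (volume : Measure (EuclideanSpace ℝ (Fin n))) 0 ρ)
      simpa using this
    filter_upwards [hs r, hs (2 * r)] with x h1 h2
    rcases h1.lt_or_gt with h1 | h1
    · rw [(reflectExtend_eventuallyEq_of_norm_lt hr h1).fderiv_eq,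
        indicator_of_mem (by simpa using h1)]
      exact le_self_add
    rcases h2.lt_or_gt with h2 | h2
    · obtain ⟨D, hD, hDle⟩ := exists_hasFDerivAt_reflectExtend hr hw h1 h2
      rw [hD.fderiv, indicator_of_mem (s := T) ⟨h1, h2⟩]
      refine le_trans ?_ le_add_self
      set y := EuclideanGeometry.inversion 0 r x
      have hDe : ‖D‖ₑ ≤ c * (‖w y‖ₑ + ‖fderiv ℝ w y‖ₑ) := by
        calc ‖D‖ₑ ≤ c * ‖w y‖ₑ + ‖fderiv ℝ w y‖ₑ := by
              simp only [hc, ← ofReal_norm]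
              rw [← ENNReal.ofReal_mul (by positivity),
                ← ENNReal.ofReal_add (by positivity) (by positivity)]
              exact ENNReal.ofReal_le_ofReal hDle
          _ ≤ c * ‖w y‖ₑ + c * ‖fderiv ℝ w y‖ₑ := by
              gcongr
              exact le_mul_of_one_le_left' hc1
          _ = _ := by ring
      calc ‖D‖ₑ ^ q ≤ (c * (‖w y‖ₑ + ‖fderiv ℝ w y‖ₑ)) ^ q := by gcongr
        _ = c ^ q * (‖w y‖ₑ + ‖fderiv ℝ w y‖ₑ) ^ q := ENNReal.mul_rpow_of_nonneg _ _ hq0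
        _ ≤ c ^ q * (2 ^ (q - 1) * (‖w y‖ₑ ^ q + ‖fderiv ℝ w y‖ₑ ^ q)) := by
          gcongr
          exact ENNReal.rpow_add_le_mul_rpow_add_rpow _ _ hq
        _ = K * H y := by rw [hK, hH]; ring
    · rw [(reflectExtend_eventuallyEq_zero hr h2).fderiv_eq, fderiv_fun_const,
        Pi.zero_apply, ← ofReal_norm, norm_zero, ENNReal.ofReal_zero,
        ENNReal.zero_rpow_of_pos (by linarith : 0 < q)]
      exact bot_le
  calc ∫⁻ x, ‖fderiv ℝ (reflectExtend r w) x‖ₑ ^ q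
      ≤ (∫⁻ x in ball 0 r, ‖fderiv ℝ w x‖ₑ ^ q) +
        ∫⁻ x in T, K * H (EuclideanGeometry.inversion 0 r x) := by
        refine (lintegral_mono_ae hae).trans (le_of_eq ?_)
        rw [lintegral_add_left, lintegral_indicator measurableSet_ball, lintegral_indicator hTm]
        exact ((measurable_fderiv ℝ w).enorm.pow_const _).indicator measurableSet_ball
    _ ≤ (∫⁻ x in ball 0 r, H x) + K * (4 ^ n * ∫⁻ x in ball 0 r, H x) := by
        rw [lintegral_const_mul' _ _ hKtop]
        gcongr
        · exact le_add_self
        · exact lintegral_comp_inversion_le hr H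
    _ ≤ c ^ q * (∫⁻ x in ball 0 r, H x) + K * (4 ^ n * ∫⁻ x in ball 0 r, H x) := by
        gcongr
        exact le_mul_of_one_le_left' (ENNReal.one_le_rpow hc1 (by linarith))
    _ = c ^ q * (1 + 2 ^ (q - 1) * 4 ^ n) * ∫⁻ x in ball 0 r, H x := by rw [hK]; ring
    _ ≤ c ^ q * (1 + 4 ^ n) ^ q * ∫⁻ x in ball 0 r, H x := by
        gcongr
        exact one_add_two_rpow_mul_le hq n
    _ = _ := by rw [ENNReal.mul_rpow_of_nonneg _ _ hq0]

theorem sobolev_ball_of_lt (hn : 2 ≤ n) {q : ℝ} (hq : 1 ≤ q) (hqn : q < n) (hr : 0 < r)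
    (hr1 : r < 1) (hw : DifferentiableOn ℝ w (ball 0 1)) :
    (∫⁻ x in ball 0 r, ‖w x‖ₑ ^ (n * q / (n - q))) ^ ((n - q) / (n * q)) ≤
      ENNReal.ofReal (q * (n - 1) / (n - q) * r⁻¹) * (1 + 4 ^ n) *
        (∫⁻ x in ball 0 1, (‖w x‖ₑ ^ q + ‖fderiv ℝ w x‖ₑ ^ q)) ^ (1 / q) := by
  have hn1 : (1 : ℝ) ≤ n := by exact_mod_cast (by omega : 1 ≤ n)
  have hnq : 0 < n - q := sub_pos.2 hqn
  have hw' : ∀ y, ‖y‖ < r → DifferentiableAt ℝ w y := fun y hy =>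
    hw.differentiableAt (isOpen_ball.mem_nhds (by simpa using hy.trans hr1))
  have hcont : ContinuousOn w (closedBall 0 r) :=
    hw.continuousOn.mono (closedBall_subset_ball hr1)
  have key := sobolev_of_hasCompactSupport hn hq hqn (continuous_reflectExtend hr hcont)
    (hasCompactSupport_reflectExtend hr) (S := {x | ‖x‖ = r ∨ ‖x‖ = 2 * r})
    (fun x i => (countable_norm_toLp_update_eq x i r).union
      (countable_norm_toLp_update_eq x i (2 * r)))
    (fun x hx => differentiableAt_reflectExtend hr hw' (fun h => hx (.inl h))
      (fun h => hx (.inr h)))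
  calc _ ≤ (∫⁻ x, ‖reflectExtend r w x‖ₑ ^ (n * q / (n - q))) ^ ((n - q) / (n * q)) := by
        have : 0 ≤ (n - q) / (n * q) := by positivity
        refine ENNReal.rpow_le_rpow ?_ this
        refine le_trans (le_of_eq ?_) (setLIntegral_le_lintegral (ball 0 r) _)
        refine setLIntegral_congr_fun measurableSet_ball fun x hx => ?_
        simp only [reflectExtend_of_norm_le hr (mem_ball_zero_iff.1 hx).le]
    _ ≤ _ := key
    _ ≤ ENNReal.ofReal (q * (n - 1) / (n - q)) * ((ENNReal.ofReal r⁻¹ * (1 + 4 ^ n)) ^ q *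
        ∫⁻ x in ball 0 1, (‖w x‖ₑ ^ q + ‖fderiv ℝ w x‖ₑ ^ q)) ^ (1 / q) := by
        gcongr
        refine (lintegral_enorm_fderiv_reflectExtend_le (by omega) hq hr hr1.le hw').trans ?_
        gcongr
    _ = _ := by
        have hγ : 0 ≤ q * (n - 1) / (n - q) :=
          div_nonneg (mul_nonneg (by linarith) (by linarith)) hnq.le
        rw [ENNReal.mul_rpow_of_nonneg _ _ (by positivity : 0 ≤ 1 / q), ← ENNReal.rpow_mul,
          mul_one_div_cancel (by linarith), ENNReal.rpow_one, ENNReal.ofReal_mul hγ]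
        ring

end Reflection

theorem sobolev_unit_ball {n : ℕ} (hn : 2 ≤ n) {q C : ℝ} (hq : 1 ≤ q) (hqn : q < n)
    (hC : q * (n - 1) / (n - q) < C) {w : EuclideanSpace ℝ (Fin n) → ℝ}
    (hw : DifferentiableOn ℝ w (ball 0 1)) :
    (∫⁻ x in ball 0 1, ‖w x‖ₑ ^ (n * q / (n - q))) ^ ((n - q) / (n * q)) ≤
      ENNReal.ofReal C * (1 + 4 ^ n) *
        (∫⁻ x in ball 0 1, (‖w x‖ₑ ^ q + ‖fderiv ℝ w x‖ₑ ^ q)) ^ (1 / q) := by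
  have hn2 : (2 : ℝ) ≤ n := by exact_mod_cast hn
  have hnq : 0 < n - q := sub_pos.2 hqn
  set γ : ℝ := q * (n - 1) / (n - q) with hγ
  have hγ0 : 0 < γ := div_pos (mul_pos (by linarith) (by linarith)) hnq
  have hC0 : 0 < C := hγ0.trans hC
  have hs : 0 < (n - q) / (n * q) := by positivity
  have hs' : ((n - q) / (n * q))⁻¹ = n * q / (n - q) := inv_div _ _
  obtain ⟨r, hrmono, hrmem, hrlim⟩ := exists_seq_strictMono_tendsto' ((div_lt_one hC0).2 hC)
  have hunion : ball (0 : EuclideanSpace ℝ (Fin n)) 1 = ⋃ k, ball 0 (r k) := by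
    ext x
    simp only [mem_ball_zero_iff, mem_iUnion]
    exact ⟨fun hx => (hrlim.eventually_const_lt hx).exists,
      fun ⟨k, hk⟩ => hk.trans (hrmem k).2⟩
  rw [← ENNReal.le_rpow_inv_iff hs]
  conv_lhs => rw [hunion]
  rw [setLIntegral_iUnion_of_directed _
    (directed_of_isDirected_le fun i j hij => ball_subset_ball (hrmono.monotone hij))]
  refine iSup_le fun k => ?_
  have hk0 : 0 < r k := (div_pos hγ0 hC0).trans (hrmem k).1
  rw [ENNReal.le_rpow_inv_iff hs]
  refine (sobolev_ball_of_lt hn hq hqn hk0 (hrmem k).2 hw).trans ?_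
  gcongr
  rw [← hγ, ← div_eq_mul_inv, div_le_iff₀ hk0]
  have := (div_lt_iff₀ hC0).1 (hrmem k).1
  linarith

theorem stmt9 (n : ℕ) (hn : 2 ≤ n) (β : ℝ) (hβ : 1 ≤ β) :
    ∀ q : ℝ, 1 ≤ q → q ≤ (n : ℝ) * β / ((n : ℝ) + β - 1) →
    ∀ w : EuclideanSpace ℝ (Fin n) → ℝ,
      DifferentiableOn ℝ w (Metric.ball 0 1) →
      MeasureTheory.IntegrableOn (fun x => |w x| ^ q) (Metric.ball 0 1) →
      MeasureTheory.IntegrableOn (fun x => ‖fderiv ℝ w x‖ ^ q) (Metric.ball 0 1) →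
      (∫ x in Metric.ball (0 : EuclideanSpace ℝ (Fin n)) 1,
          |w x| ^ ((n : ℝ) * q / ((n : ℝ) - q))) ^ (((n : ℝ) - q) / ((n : ℝ) * q))
        ≤ (1 + 4 ^ n) * ((n : ℝ) + β - 1) *
          (∫ x in Metric.ball (0 : EuclideanSpace ℝ (Fin n)) 1,
            (|w x| ^ q + ‖fderiv ℝ w x‖ ^ q)) ^ (1 / q) := by
  intro q hq hqβ w hw hi1 hi2
  have hn2 : (2 : ℝ) ≤ n := by exact_mod_cast hn
  have hD : 0 < n + β - 1 := by linarith
  rw [le_div_iff₀ hD] at hqβ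
  have hqn : q < n := by nlinarith
  have hnq : 0 < n - q := sub_pos.2 hqn
  have hq0 : 0 ≤ q := by linarith
  have hC : q * (n - 1) / (n - q) < n + β - 1 := by
    rw [div_lt_iff₀ hnq]
    nlinarith
  have key := sobolev_unit_ball hn hq hqn hC hw
  have e : ∀ {a p : ℝ}, 0 ≤ p → ‖a‖ₑ ^ p = ENNReal.ofReal (|a| ^ p) := fun {a p} hp => by
    rw [← ofReal_norm, Real.norm_eq_abs, ENNReal.ofReal_rpow_of_nonneg (abs_nonneg _) hp]
  have e' : ∀ x, ‖fderiv ℝ w x‖ₑ ^ q = ENNReal.ofReal (‖fderiv ℝ w x‖ ^ q) := fun x => by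
    rw [← ofReal_norm, ENNReal.ofReal_rpow_of_nonneg (norm_nonneg _) hq0]
  have hs : 0 ≤ n * q / (n - q) := by positivity
  have hsum : ∫⁻ x in ball 0 1, (‖w x‖ₑ ^ q + ‖fderiv ℝ w x‖ₑ ^ q) =
      ENNReal.ofReal (∫ x in ball 0 1, (|w x| ^ q + ‖fderiv ℝ w x‖ ^ q)) := by
    have hi : IntegrableOn (fun x => |w x| ^ q + ‖fderiv ℝ w x‖ ^ q) (ball 0 1) := hi1.add hi2
    rw [ofReal_integral_eq_lintegral_ofReal hi (ae_of_all _ fun x => by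
      simp only [Pi.zero_apply]; positivity)]
    congr! 2 with x
    rw [e hq0, e', ENNReal.ofReal_add (by positivity) (by positivity)]
  have hI : 0 ≤ ∫ x in ball 0 1, (|w x| ^ q + ‖fderiv ℝ w x‖ ^ q) :=
    integral_nonneg fun x => by positivity
  have hmeas : AEStronglyMeasurable (fun x => |w x| ^ (n * q / (n - q)))
      (volume.restrict (ball (0 : EuclideanSpace ℝ (Fin n)) 1)) :=
    (hw.continuousOn.abs.rpow_const fun _ _ => .inr hs).aestronglyMeasurable measurableSet_ball
  rw [hsum, ENNReal.ofReal_rpow_of_nonneg hI (by positivity)] at key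
  have key' := ENNReal.toReal_mono (by finiteness) key
  rw [← ENNReal.toReal_rpow, ENNReal.toReal_mul, ENNReal.toReal_mul, ENNReal.toReal_ofReal hD.le,
    ENNReal.toReal_ofReal (by positivity)] at key'
  rw [integral_eq_lintegral_of_nonneg_ae (ae_of_all _ fun x => by
      simp only [Pi.zero_apply]; positivity) hmeas]
  simp_rw [e hs] at key'
  refine key'.trans (le_of_eq ?_)
  have : (1 + 4 ^ n : ℝ≥0∞).toReal = 1 + 4 ^ n := by
    rw [ENNReal.toReal_add (by simp) (by simp)]
    simp
  rw [this]
  ring
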